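/- arXiv:1402.4285 — 4 statements merged into one kernel-verified Lean document; each statement's English description precedes it below -/
import Mathlib

section
/- Let a, b, c > 0 be real numbers and s a complex number with Re(s) > 0. Then the three families e^{-2ams/c} (m ≥ 1), (-1)^{n-1} e^{-2bns/c} (n ≥ 1), and (-1)^{n-1} e^{-2(bn+am)s/c} ((m,n) with m,n ≥ 1) are absolutely summable, and coth(as/c)·tanh(bs/c) − 1 = 2 ∑_{m=1}^∞ e^{-2ams/c} − 2 ∑_{n=1}^∞ (-1)^{n-1} e^{-2bns/c} − 4 ∑_{n=1}^∞ ∑_{m=1}^∞ (-1)^{n-1} e^{-2(bn+am)s/c}. -/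
open Complex

/-- `coth z` in terms of the sum of the geometric series of ratio `e^{-2z}`. -/
theorem cosh_div_sinh_eq_one_add_geometric {z : ℂ} (hz : 1 - exp (-2 * z) ≠ 0) :
    cosh z / sinh z = 1 + 2 * (exp (-2 * z) * (1 - exp (-2 * z))⁻¹) := by
  have hexp : exp (-z) = exp z * exp (-2 * z) := by
    rw [← Complex.exp_add]
    ring_nf
  have hne := Complex.exp_ne_zero z
  rw [Complex.cosh, Complex.sinh, hexp]
  generalize exp (-2 * z) = x at *
  have hsub : exp z - exp z * x ≠ 0 := by
    rw [← mul_one_sub]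
    exact mul_ne_zero hne hz
  field_simp
  ring

/-- `tanh z` in terms of the sum of the geometric series of ratio `-e^{-2z}`. -/
theorem tanh_eq_one_sub_geometric {z : ℂ} (hz : 1 + exp (-2 * z) ≠ 0) :
    tanh z = 1 - 2 * (exp (-2 * z) * (1 + exp (-2 * z))⁻¹) := by
  have hexp : exp (-z) = exp z * exp (-2 * z) := by
    rw [← Complex.exp_add]
    ring_nf
  have hne := Complex.exp_ne_zero z
  rw [Complex.tanh_eq_sinh_div_cosh, Complex.cosh, Complex.sinh, hexp]
  generalize exp (-2 * z) = x at *
  have hadd : exp z + exp z * x ≠ 0 := by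
    rw [← mul_one_add]
    exact mul_ne_zero hne hz
  field_simp
  ring

theorem exp_neg_two_mul_natCast_add_one (a s c : ℂ) (m : ℕ) :
    exp (-2 * a * ((m : ℂ) + 1) * s / c) =
      exp (-2 * (a * s / c)) * exp (-2 * (a * s / c)) ^ m := by
  rw [← pow_succ', ← Complex.exp_nat_mul]
  push_cast
  ring_nf

theorem norm_exp_neg_two_mul_lt_one {a c : ℝ} (ha : 0 < a) (hc : 0 < c)
    {s : ℂ} (hs : 0 < s.re) : ‖exp (-2 * ((a : ℂ) * s / c))‖ < 1 := by
  rw [Complex.norm_exp, Real.exp_lt_one_iff]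
  have hre : (-2 * ((a : ℂ) * s / c)).re = -2 * (a * s.re / c) := by
    have : -2 * ((a : ℂ) * s / c) = ((-2 * a / c : ℝ) : ℂ) * s := by
      push_cast
      ring
    rw [this, Complex.re_ofReal_mul]
    ring
  have : 0 < a * s.re / c := by positivity
  rw [hre]
  linarith

/-- Kernel expansion for the DNWR convergence kernel
`G_b^a(s) = coth(as/c)·tanh(bs/c) − 1`, where `coth z = cosh z / sinh z`:
the three exponential families are absolutely summable and
`G_b^a(s) = 2 ∑_{m≥1} e^{-2ams/c} − 2 ∑_{n≥1} (-1)^{n-1} e^{-2bns/c}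
            − 4 ∑_{n≥1} ∑_{m≥1} (-1)^{n-1} e^{-2(bn+am)s/c}`.
Sums over indices `≥ 1` are indexed by `ℕ` via `m ↦ m + 1`, `n ↦ n + 1`. -/
theorem DNWR_kernel_expansion (a b c : ℝ) (ha : 0 < a) (hb : 0 < b) (hc : 0 < c)
    (s : ℂ) (hs : 0 < s.re) :
    Summable (fun m : ℕ => ‖exp (-2 * (a : ℂ) * ((m : ℂ) + 1) * s / c)‖) ∧
    Summable (fun n : ℕ => ‖(-1 : ℂ) ^ n * exp (-2 * (b : ℂ) * ((n : ℂ) + 1) * s / c)‖) ∧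
    Summable (fun p : ℕ × ℕ => ‖(-1 : ℂ) ^ p.2 *
      exp (-2 * ((b : ℂ) * ((p.2 : ℂ) + 1) + (a : ℂ) * ((p.1 : ℂ) + 1)) * s / c)‖) ∧
    cosh ((a : ℂ) * s / c) / sinh ((a : ℂ) * s / c) * tanh ((b : ℂ) * s / c) - 1 =
      2 * (∑' m : ℕ, exp (-2 * (a : ℂ) * ((m : ℂ) + 1) * s / c))
      - 2 * (∑' n : ℕ, (-1 : ℂ) ^ n * exp (-2 * (b : ℂ) * ((n : ℂ) + 1) * s / c))
      - 4 * (∑' n : ℕ, ∑' m : ℕ, (-1 : ℂ) ^ n *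
          exp (-2 * ((b : ℂ) * ((n : ℂ) + 1) + (a : ℂ) * ((m : ℂ) + 1)) * s / c)) := by
  have hx := norm_exp_neg_two_mul_lt_one ha hc hs
  have hy := norm_exp_neg_two_mul_lt_one hb hc hs
  have hmul : ∀ m n : ℕ, (-1 : ℂ) ^ n *
      exp (-2 * ((b : ℂ) * ((n : ℂ) + 1) + (a : ℂ) * ((m : ℂ) + 1)) * s / c) =
      exp (-2 * (a : ℂ) * ((m : ℂ) + 1) * s / c) *
        ((-1 : ℂ) ^ n * exp (-2 * (b : ℂ) * ((n : ℂ) + 1) * s / c)) := by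
    intro m n
    rw [mul_left_comm, ← Complex.exp_add]
    ring_nf
  simp only [hmul]
  simp only [exp_neg_two_mul_natCast_add_one]
  have hcoth := @cosh_div_sinh_eq_one_add_geometric ((a : ℂ) * s / c)
  have htanh := @tanh_eq_one_sub_geometric ((b : ℂ) * s / c)
  generalize exp (-2 * ((a : ℂ) * s / c)) = x at hx hcoth ⊢
  generalize exp (-2 * ((b : ℂ) * s / c)) = y at hy htanh ⊢
  have hny : ‖-y‖ < 1 := by rwa [norm_neg]
  have halt : ∀ n : ℕ, (-1 : ℂ) ^ n * (y * y ^ n) = y * (-y) ^ n := by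
    intro n
    rw [neg_pow y]
    ring
  simp only [halt]
  have hX : Summable fun m : ℕ => ‖x * x ^ m‖ := by
    simpa only [norm_mul, norm_pow] using
      (summable_geometric_of_lt_one (norm_nonneg x) hx).mul_left ‖x‖
  have hY : Summable fun n : ℕ => ‖y * (-y) ^ n‖ := by
    simpa only [norm_mul, norm_pow] using
      (summable_geometric_of_lt_one (norm_nonneg (-y)) hny).mul_left ‖y‖
  refine ⟨hX, hY, Summable.mul_norm (f := fun m : ℕ => x * x ^ m)
    (g := fun n : ℕ => y * (-y) ^ n) hX hY, ?_⟩
  have hx1 : 1 - x ≠ 0 := fun h => by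
    rw [← sub_eq_zero.mp h, norm_one] at hx
    exact lt_irrefl _ hx
  have hy1 : 1 + y ≠ 0 := fun h => by
    rw [← eq_neg_of_add_eq_zero_left h, norm_one] at hny
    exact lt_irrefl _ hny
  simp only [tsum_mul_right, tsum_mul_left, tsum_geometric_of_norm_lt_one hx,
    tsum_geometric_of_norm_lt_one hny, sub_neg_eq_add]
  rw [hcoth hx1, htanh hy1]
  ring
end

section
/- Let a, b, c > 0 be real numbers, s a complex number with Re(s) > 0, and h ∈ ℂ. Suppose u : ℝ → ℂ is twice differentiable and satisfies c² u''(x) = s² u(x) for all x ∈ [0, b], together with the boundary conditions u'(0) = (s/c)·coth(as/c)·h and u(b) = 0. Then u(x) = h · (coth(as/c)/cosh(bs/c)) · sinh((x−b)s/c) for all x ∈ [0, b], and in particular u(0) = −coth(as/c)·tanh(bs/c)·h. -/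
open Complex

theorem Complex.cosh_ne_zero_of_re_pos {z : ℂ} (hz : 0 < z.re) : cosh z ≠ 0 := by
  intro h0
  have h1 : exp z = -exp (-z) := by
    rw [cosh] at h0
    linear_combination 2 * h0
  have h2 := congrArg norm h1
  rw [norm_neg, norm_exp, norm_exp, Real.exp_eq_exp, neg_re] at h2
  linarith

/-- Cauchy's representation of the solutions of `u'' = k² u` on `[0, b]` by their data at `0`. -/
theorem mul_eq_cosh_add_sinh_of_deriv_deriv_eq {b : ℝ} {k : ℂ} {u : ℝ → ℂ}
    (hu1 : Differentiable ℝ u) (hu2 : Differentiable ℝ (deriv u))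
    (hode : ∀ x ∈ Set.Icc 0 b, deriv (deriv u) x = k ^ 2 * u x)
    {y : ℝ} (hy : y ∈ Set.Icc 0 b) :
    k * u y = k * u 0 * cosh (k * y) + deriv u 0 * sinh (k * y) := by
  let W : ℝ → ℂ := fun x =>
    k * u x * cosh (k * ((y : ℂ) - x)) + deriv u x * sinh (k * ((y : ℂ) - x))
  have hW : ∀ x ∈ Set.Icc 0 b, HasDerivAt W 0 x := by
    intro x hx
    have hl : HasDerivAt (fun x : ℝ => k * ((y : ℂ) - x)) (k * (-1)) x :=
      ((hasDerivAt_id x).ofReal_comp.const_sub (y : ℂ)).const_mul k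
    have h := (((hu1 x).hasDerivAt.const_mul k).mul
      ((hasDerivAt_cosh _).comp x hl)).add
      ((hu2 x).hasDerivAt.mul ((hasDerivAt_sinh _).comp x hl))
    refine h.congr_deriv ?_
    rw [hode x hx]
    simp only [Function.comp_apply]
    ring
  have hconst := constant_of_has_deriv_right_zero
    (fun x hx => (hW x hx).continuousAt.continuousWithinAt)
    (fun x hx => (hW x (Set.Ico_subset_Icc_self hx)).hasDerivWithinAt) y hy
  simpa [W] using hconst


/-- Laplace-transformed Neumann subdomain problem of DNWR on `(0, b)`:
if `u` is twice differentiable, satisfies `c² u'' = s² u` on `[0, b]`, and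
`u'(0) = (s/c)·coth(as/c)·h`, `u(b) = 0`, then
`u(x) = h·(coth(as/c)/cosh(bs/c))·sinh((x−b)s/c)` on `[0, b]` and
`u(0) = −coth(as/c)·tanh(bs/c)·h`, with `coth z = cosh z / sinh z`. -/
theorem DNWR_neumann_subdomain (a b c : ℝ) (ha : 0 < a) (hb : 0 < b) (hc : 0 < c)
    (s : ℂ) (hs : 0 < s.re) (h : ℂ) (u : ℝ → ℂ)
    (hu1 : Differentiable ℝ u) (hu2 : Differentiable ℝ (deriv u))
    (hode : ∀ x ∈ Set.Icc 0 b, (c : ℂ) ^ 2 * deriv (deriv u) x = s ^ 2 * u x)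
    (hbc1 : deriv u 0 = s / c * (cosh ((a : ℂ) * s / c) / sinh ((a : ℂ) * s / c)) * h)
    (hbc2 : u b = 0) :
    (∀ x ∈ Set.Icc 0 b,
      u x = h * (cosh ((a : ℂ) * s / c) / sinh ((a : ℂ) * s / c) / cosh ((b : ℂ) * s / c))
        * sinh (((x : ℂ) - b) * s / c)) ∧
    u 0 = -(cosh ((a : ℂ) * s / c) / sinh ((a : ℂ) * s / c)) * tanh ((b : ℂ) * s / c) * h := by
  have hc0 : (c : ℂ) ≠ 0 := ofReal_ne_zero.mpr hc.ne'
  have hs0 : s ≠ 0 := by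
    rintro rfl
    simp at hs
  have hk : s / c ≠ 0 := div_ne_zero hs0 hc0
  have hcosh : cosh (s / c * b) ≠ 0 := by
    apply cosh_ne_zero_of_re_pos
    rw [re_mul_ofReal, div_ofReal_re]
    positivity
  have hode' : ∀ x ∈ Set.Icc 0 b, deriv (deriv u) x = (s / c) ^ 2 * u x := by
    intro x hx
    have := hode x hx
    field_simp
    linear_combination this
  have hrep := fun y (hy : y ∈ Set.Icc 0 b) =>
    mul_eq_cosh_add_sinh_of_deriv_deriv_eq hu1 hu2 hode' hy
  have hbs : (b : ℂ) * s / c = s / c * b := by ring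
  rw [hbs]
  generalize cosh ((a : ℂ) * s / c) / sinh ((a : ℂ) * s / c) = q at *
  have hsub : ∀ x : ℝ, ((x : ℂ) - b) * s / c = s / c * x - s / c * b := fun x => by ring
  simp only [hsub, sinh_sub]
  generalize s / (c : ℂ) = k at *
  have hB := hrep b ⟨hb.le, le_rfl⟩
  rw [hbc2, hbc1] at hB
  have hu0 : u 0 * cosh (k * b) = -q * h * sinh (k * b) :=
    mul_left_cancel₀ hk (by linear_combination -hB)
  constructor
  · intro x hx
    have hX := hrep x hx
    rw [hbc1] at hX
    have hX' : u x = u 0 * cosh (k * x) + q * h * sinh (k * x) :=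
      mul_left_cancel₀ hk (by linear_combination hX)
    rw [hX']
    field_simp
    linear_combination cosh (k * x) * hu0
  · rw [tanh_eq_sinh_div_cosh]
    field_simp
    linear_combination hu0
end

section
/- Let a, b, c > 0 be real numbers and σ > 0. Then there exists a constant C > 0 such that for every complex number s with Re(s) ≥ σ, |coth(as/c)·tanh(bs/c) − 1| ≤ C·e^{−2·min(a,b)·Re(s)/c}. -/
open Complex

/-- Hyperbolic cotangent in terms of `exp (-2 * z)`. -/
theorem cosh_div_sinh_eq_exp (z : ℂ) :
    cosh z / sinh z = (1 + exp (-2 * z)) / (1 - exp (-2 * z)) := by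
  have h : exp (-2 * z) = exp (-z) * exp (-z) := by rw [← exp_add]; ring_nf
  have h1 : exp z * exp (-z) = 1 := by rw [← exp_add]; simp
  have hc : 1 + exp (-2 * z) = (2 * exp (-z)) * cosh z := by
    rw [h, cosh]; linear_combination -h1
  have hs : 1 - exp (-2 * z) = (2 * exp (-z)) * sinh z := by
    rw [h, sinh]; linear_combination -h1
  rw [hc, hs, mul_div_mul_left _ _ (mul_ne_zero two_ne_zero (exp_ne_zero _))]

/-- Hyperbolic tangent in terms of `exp (-2 * z)`. -/
theorem tanh_eq_exp_neg_two_mul (z : ℂ) :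
    tanh z = (1 - exp (-2 * z)) / (1 + exp (-2 * z)) := by
  rw [tanh_eq_sinh_div_cosh, ← inv_div, cosh_div_sinh_eq_exp, inv_div]

theorem norm_mobius_mul_sub_one_le {p q : ℂ} {E r : ℝ} (hp : ‖p‖ ≤ E) (hq : ‖q‖ ≤ E)
    (hE : E ≤ r) (hr : r < 1) :
    ‖(1 + p) / (1 - p) * ((1 - q) / (1 + q)) - 1‖ ≤ 4 / (1 - r) ^ 2 * E := by
  have hr' : 0 < 1 - r := sub_pos.mpr hr
  have hp' : 1 - r ≤ ‖1 - p‖ := by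
    have := norm_sub_norm_le (1 : ℂ) p
    rw [norm_one] at this
    linarith
  have hq' : 1 - r ≤ ‖1 + q‖ := by
    have := norm_sub_le_norm_add (1 : ℂ) q
    rw [norm_one] at this
    linarith
  have hp0 : 1 - p ≠ 0 := norm_pos_iff.mp (hr'.trans_le hp')
  have hq0 : 1 + q ≠ 0 := norm_pos_iff.mp (hr'.trans_le hq')
  have key : (1 + p) / (1 - p) * ((1 - q) / (1 + q)) - 1
      = 2 * (p - q) / ((1 - p) * (1 + q)) := by
    field_simp
    ring
  have hnum : ‖2 * (p - q)‖ ≤ 4 * E := by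
    have := norm_sub_le p q
    rw [norm_mul, Complex.norm_ofNat]
    linarith
  rw [key, norm_div, norm_mul (1 - p), div_mul_eq_mul_div, sq]
  gcongr
  exact (norm_nonneg _).trans hnum

/-- Exponential decay of the DNWR kernel `G_b^a(s) = coth(as/c)·tanh(bs/c) − 1`
(with `coth z = cosh z / sinh z`) on the half-plane `Re s ≥ σ`:
`|G_b^a(s)| ≤ C·e^{−2·min(a,b)·Re(s)/c}`. -/
theorem DNWR_kernel_decay (a b c σ : ℝ) (ha : 0 < a) (hb : 0 < b) (hc : 0 < c)
    (hσ : 0 < σ) :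
    ∃ C : ℝ, 0 < C ∧ ∀ s : ℂ, σ ≤ s.re →
      ‖cosh ((a : ℂ) * s / c) / sinh ((a : ℂ) * s / c) * tanh ((b : ℂ) * s / c) - 1‖
        ≤ C * Real.exp (-2 * min a b * s.re / c) := by
  have hm : 0 < min a b := lt_min ha hb
  have hr : Real.exp (-2 * min a b * σ / c) < 1 := by
    rw [Real.exp_lt_one_iff, neg_mul, neg_mul, neg_div, neg_lt_zero]
    positivity
  refine ⟨4 / (1 - Real.exp (-2 * min a b * σ / c)) ^ 2,
    div_pos four_pos (pow_pos (sub_pos.mpr hr) 2), fun s hs => ?_⟩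
  have hs0 : 0 ≤ s.re := hσ.le.trans hs
  have hnorm (d : ℝ) (hd : min a b ≤ d) :
      ‖exp (-2 * ((d : ℂ) * s / c))‖ ≤ Real.exp (-2 * min a b * s.re / c) := by
    have h : (-2 * ((d : ℂ) * s / c)) = ((-2 * d / c : ℝ) : ℂ) * s := by push_cast; ring
    rw [norm_exp, h, re_ofReal_mul, Real.exp_le_exp, div_mul_eq_mul_div]
    gcongr ?_ / c
    nlinarith [mul_le_mul_of_nonneg_right hd hs0]
  rw [cosh_div_sinh_eq_exp, tanh_eq_exp_neg_two_mul]
  refine norm_mobius_mul_sub_one_le (hnorm a (min_le_left a b)) (hnorm b (min_le_right a b)) ?_ hr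
  rw [Real.exp_le_exp]
  gcongr ?_ / c
  nlinarith [mul_le_mul_of_nonneg_left hs hm.le]
end

section
/- Let a, b, c > 0 be real numbers and σ > 0. Then there exists a constant C > 0 such that for every complex number s with Re(s) ≥ σ, |(coth(as/c)·tanh(bs/c) − 1) + (coth(bs/c)·tanh(as/c) − 1)| ≤ C·e^{−4·min(a,b)·Re(s)/c}. -/
open Complex

theorem norm_sinh_le_exp_abs_re (z : ℂ) : ‖sinh z‖ ≤ Real.exp |z.re| := by
  have h : ‖exp z - exp (-z)‖ ≤ Real.exp |z.re| + Real.exp |z.re| := by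
    refine (norm_sub_le _ _).trans ?_
    rw [norm_exp, norm_exp, neg_re]
    gcongr
    · exact le_abs_self _
    · exact neg_le_abs _
  rw [Complex.sinh, norm_div, Complex.norm_ofNat]
  linarith

theorem exp_mul_le_norm_sinh_mul_cosh {p : ℝ} {z : ℂ} (hz : p ≤ z.re) :
    (1 - Real.exp (-4 * p)) / 4 * Real.exp (2 * z.re) ≤ ‖sinh z * cosh z‖ := by
  have hs : sinh z * cosh z = (exp (2 * z) - exp (-(2 * z))) / 4 := by
    have h := Complex.sinh_two_mul z
    rw [Complex.sinh] at h
    linear_combination -h / 2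
  have hn := norm_sub_norm_le (exp (2 * z)) (exp (-(2 * z)))
  have hre : (2 * z).re = 2 * z.re := by simp
  rw [norm_exp, norm_exp, neg_re, hre] at hn
  have he : Real.exp (-(2 * z.re)) ≤ Real.exp (-4 * p) * Real.exp (2 * z.re) := by
    rw [← Real.exp_add]
    exact Real.exp_le_exp.mpr (by linarith)
  rw [hs, norm_div, Complex.norm_ofNat]
  linarith

theorem coth_mul_tanh_sub_one_add_eq {x y : ℂ} (hx : sinh x * cosh x ≠ 0)
    (hy : sinh y * cosh y ≠ 0) :
    (cosh x / sinh x * tanh y - 1) + (cosh y / sinh y * tanh x - 1) =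
      sinh (x - y) ^ 2 / (sinh x * cosh x * (sinh y * cosh y)) := by
  obtain ⟨hsx, hcx⟩ := mul_ne_zero_iff.mp hx
  obtain ⟨hsy, hcy⟩ := mul_ne_zero_iff.mp hy
  rw [Complex.sinh_sub, Complex.tanh_eq_sinh_div_cosh, Complex.tanh_eq_sinh_div_cosh]
  field_simp
  ring

theorem norm_coth_mul_tanh_sub_one_add_le {p q : ℝ} (hp : 0 < p) (hq : 0 < q) {x y : ℂ}
    (hx : p ≤ x.re) (hy : q ≤ y.re) :
    ‖(cosh x / sinh x * tanh y - 1) + (cosh y / sinh y * tanh x - 1)‖ ≤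
      ((1 - Real.exp (-4 * p)) / 4 * ((1 - Real.exp (-4 * q)) / 4))⁻¹ *
        Real.exp (-4 * min x.re y.re) := by
  have hP : 0 < (1 - Real.exp (-4 * p)) / 4 := by
    have : Real.exp (-4 * p) < 1 := Real.exp_lt_one_iff.mpr (by linarith)
    linarith
  have hQ : 0 < (1 - Real.exp (-4 * q)) / 4 := by
    have : Real.exp (-4 * q) < 1 := Real.exp_lt_one_iff.mpr (by linarith)
    linarith
  have hX := exp_mul_le_norm_sinh_mul_cosh hx
  have hY := exp_mul_le_norm_sinh_mul_cosh hy
  have hX0 := (mul_pos hP (Real.exp_pos _)).trans_le hX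
  have hY0 := (mul_pos hQ (Real.exp_pos _)).trans_le hY
  rw [coth_mul_tanh_sub_one_add_eq (norm_pos_iff.mp hX0) (norm_pos_iff.mp hY0), norm_div,
    norm_mul (sinh x * cosh x), norm_pow, div_le_iff₀ (mul_pos hX0 hY0)]
  have hexp : Real.exp |(x - y).re| ^ 2 =
      Real.exp (-4 * min x.re y.re) * (Real.exp (2 * x.re) * Real.exp (2 * y.re)) := by
    rw [← Real.exp_nat_mul, ← Real.exp_add, ← Real.exp_add, sub_re]
    congr 1
    rcases le_total x.re y.re with h | h
    · rw [min_eq_left h, abs_of_nonpos (by linarith)]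
      push_cast
      ring
    · rw [min_eq_right h, abs_of_nonneg (by linarith)]
      push_cast
      ring
  generalize (1 - Real.exp (-4 * p)) / 4 = P at *
  generalize (1 - Real.exp (-4 * q)) / 4 = Q at *
  calc ‖sinh (x - y)‖ ^ 2 ≤ Real.exp |(x - y).re| ^ 2 := by
        gcongr
        exact norm_sinh_le_exp_abs_re _
    _ = (P * Q)⁻¹ * Real.exp (-4 * min x.re y.re) *
        (P * Real.exp (2 * x.re) * (Q * Real.exp (2 * y.re))) := by
        rw [hexp]
        field_simp
    _ ≤ _ := by gcongr

/-- Exponential decay of the NNWR kernel `G_b^a(s) + G_a^b(s)`, with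
`G_b^a(s) = coth(as/c)·tanh(bs/c) − 1` and `coth z = cosh z / sinh z`, on the
half-plane `Re s ≥ σ`: `|G_b^a(s) + G_a^b(s)| ≤ C·e^{−4·min(a,b)·Re(s)/c}`. -/
theorem NNWR_kernel_decay (a b c σ : ℝ) (ha : 0 < a) (hb : 0 < b) (hc : 0 < c)
    (hσ : 0 < σ) :
    ∃ C : ℝ, 0 < C ∧ ∀ s : ℂ, σ ≤ s.re →
      ‖(cosh ((a : ℂ) * s / c) / sinh ((a : ℂ) * s / c) * tanh ((b : ℂ) * s / c) - 1)
        + (cosh ((b : ℂ) * s / c) / sinh ((b : ℂ) * s / c) * tanh ((a : ℂ) * s / c) - 1)‖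
        ≤ C * Real.exp (-4 * min a b * s.re / c) := by
  have hre : ∀ (r : ℝ) (s : ℂ), ((r : ℂ) * s / c).re = r * s.re / c := fun r s => by
    rw [div_ofReal_re, re_ofReal_mul]
  have hpos : ∀ r : ℝ, 0 < r → 0 < 1 - Real.exp (-4 * (r * σ / c)) := fun r hr =>
    sub_pos.mpr (Real.exp_lt_one_iff.mpr (by
      have : 0 < r * σ / c := by positivity
      linarith))
  have hA := hpos a ha
  have hB := hpos b hb
  refine ⟨((1 - Real.exp (-4 * (a * σ / c))) / 4 * ((1 - Real.exp (-4 * (b * σ / c))) / 4))⁻¹,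
    by positivity, fun s hs => ?_⟩
  have hs0 : 0 ≤ s.re := hσ.le.trans hs
  have hmin : -4 * min a b * s.re / c = -4 * min (a * s.re / c) (b * s.re / c) := by
    rw [min_div_div_right hc.le, ← min_mul_of_nonneg _ _ hs0]
    ring
  rw [hmin, ← hre a s, ← hre b s]
  refine norm_coth_mul_tanh_sub_one_add_le (by positivity) (by positivity) ?_ ?_ <;>
  · rw [hre]
    gcongr
end
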